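/- Let 0 < α < 1, b ∈ ℝ, and let y be four times continuously differentiable on [b, X] with y(b) = y'(b) = y''(b) = 0 (y extended by zero to the left of b). Then for every x with b < x < X there exist constants C > 0 and h₀ > 0 such that for all 0 < h < h₀, |h^(−α)·Δ_h^α y(x) − y^(α)(x − α·h/2)| ≤ C·h². -/

import Mathlib

/-- The Caputo fractional derivative of order `α` with lower limit `b`. -/
noncomputable def caputo (α b : ℝ) (y : ℝ → ℝ) (x : ℝ) : ℝ :=
  (1 / Real.Gamma (1 - α)) * ∫ ξ in b..x, deriv y ξ * (x - ξ) ^ (-α)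

/-- The Grünwald weights `w_n^(α) = (-1)^n * C(α, n)`. -/
noncomputable def grunwaldW (α : ℝ) (n : ℕ) : ℝ :=
  (-1) ^ n * (Real.Gamma (α + 1) / (Real.Gamma ((n : ℝ) + 1) * Real.Gamma (α - (n : ℝ) + 1)))

/-- The shifted Grünwald difference operator with shift `p`, step `h`, lower limit `b`;
the (unshifted) Grünwald operator is the case `p = 0`. -/
noncomputable def shiftedGrunwald (α b p h : ℝ) (y : ℝ → ℝ) (x : ℝ) : ℝ :=
  ∑ n ∈ Finset.range (⌊(x - b) / h⌋₊ + 1), grunwaldW α n * y (x - ((n : ℝ) - p) * h)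

open Finset Filter Topology MeasureTheory

theorem grunwaldW_zero {α : ℝ} (hα : 0 < α) : grunwaldW α 0 = 1 := by
  have := (Real.Gamma_pos_of_pos (by linarith : 0 < α + 1)).ne'
  simp [grunwaldW, this]

theorem grunwaldW_succ {α : ℝ} (hα0 : 0 < α) (hα1 : α < 1) (n : ℕ) :
    ((n : ℝ) + 1) * grunwaldW α (n + 1) = (n - α) * grunwaldW α n := by
  have hne : α - n ≠ 0 := by
    rcases Nat.eq_zero_or_pos n with rfl | hn
    · simpa using hα0.ne'
    · have : (1 : ℝ) ≤ n := by exact_mod_cast hn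
      linarith
  have h1 := Real.Gamma_add_one hne
  have h2 := Real.Gamma_add_one (by positivity : (n : ℝ) + 1 ≠ 0)
  have h3 : Real.Gamma ((n : ℝ) + 1) ≠ 0 := (Real.Gamma_pos_of_pos (by positivity)).ne'
  have h4 : α - ((n : ℝ) + 1) + 1 = α - n := by ring
  have hn1 : (n : ℝ) + 1 ≠ 0 := by positivity
  unfold grunwaldW
  push_cast
  rw [h4, h1, h2]
  by_cases hG : Real.Gamma (α - n) = 0
  · simp [hG]
  · field_simp
    ring

/-- Partial sums of the Grünwald weights. -/
noncomputable def grunwaldSum (α : ℝ) (N : ℕ) : ℝ := ∑ n ∈ range (N + 1), grunwaldW α n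

theorem grunwaldSum_zero {α : ℝ} (hα : 0 < α) : grunwaldSum α 0 = 1 := by
  simp [grunwaldSum, grunwaldW_zero hα]

theorem mul_grunwaldSum {α : ℝ} (hα0 : 0 < α) (hα1 : α < 1) (N : ℕ) :
    α * grunwaldSum α N = (α - N) * grunwaldW α N := by
  induction N with
  | zero => simp [grunwaldSum]
  | succ N ih =>
    have hs : grunwaldSum α (N + 1) = grunwaldSum α N + grunwaldW α (N + 1) :=
      sum_range_succ _ _
    have hw := grunwaldW_succ hα0 hα1 N
    rw [hs]
    push_cast
    linear_combination ih + hw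

theorem grunwaldSum_succ {α : ℝ} (hα0 : 0 < α) (hα1 : α < 1) (N : ℕ) :
    ((N : ℝ) + 1) * grunwaldSum α (N + 1) = (N + 1 - α) * grunwaldSum α N := by
  have hs : grunwaldSum α (N + 1) = grunwaldSum α N + grunwaldW α (N + 1) :=
    sum_range_succ _ _
  have hw := grunwaldW_succ hα0 hα1 N
  rw [hs]
  linear_combination hw + mul_grunwaldSum hα0 hα1 N

theorem grunwaldSum_pos {α : ℝ} (hα0 : 0 < α) (hα1 : α < 1) (N : ℕ) : 0 < grunwaldSum α N := by
  induction N with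
  | zero => simp [grunwaldSum_zero hα0]
  | succ N ih =>
    have h := grunwaldSum_succ hα0 hα1 N
    have hN : (0 : ℝ) ≤ N := N.cast_nonneg
    have : 0 < ((N : ℝ) + 1) * grunwaldSum α (N + 1) := by
      rw [h]; exact mul_pos (by linarith) ih
    exact pos_of_mul_pos_right this (by positivity)

theorem sum_grunwaldW_mul {α : ℝ} (hα0 : 0 < α) (hα1 : α < 1) (N : ℕ) :
    (1 - α) * ∑ n ∈ range (N + 1), grunwaldW α n * ((N : ℝ) - n) = N * grunwaldSum α N := by
  induction N with
  | zero => simp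
  | succ N ih =>
    have h : ∑ n ∈ range (N + 1 + 1), grunwaldW α n * (((N + 1 : ℕ) : ℝ) - n) =
        ∑ n ∈ range (N + 1), grunwaldW α n * ((N : ℝ) - n) + grunwaldSum α N := by
      rw [sum_range_succ, grunwaldSum, ← sum_add_distrib]
      simp only [sub_self, mul_zero, add_zero]
      exact sum_congr rfl fun n _ => by push_cast; ring
    rw [h]
    push_cast
    linear_combination ih - grunwaldSum_succ hα0 hα1 N

theorem sum_grunwaldW_mul_sq {α : ℝ} (hα0 : 0 < α) (hα1 : α < 1) (N : ℕ) :
    (1 - α) * (2 - α) * ∑ n ∈ range (N + 1), grunwaldW α n * ((N : ℝ) - n) ^ 2 =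
      N * (2 * N - α) * grunwaldSum α N := by
  induction N with
  | zero => simp
  | succ N ih =>
    have h : ∑ n ∈ range (N + 1 + 1), grunwaldW α n * (((N + 1 : ℕ) : ℝ) - n) ^ 2 =
        ∑ n ∈ range (N + 1), grunwaldW α n * ((N : ℝ) - n) ^ 2 +
          2 * ∑ n ∈ range (N + 1), grunwaldW α n * ((N : ℝ) - n) + grunwaldSum α N := by
      rw [sum_range_succ, grunwaldSum, mul_sum, ← sum_add_distrib, ← sum_add_distrib]
      simp only [sub_self, ne_eq, OfNat.ofNat_ne_zero, not_false_eq_true, zero_pow, mul_zero,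
        add_zero]
      exact sum_congr rfl fun n _ => by push_cast; ring
    rw [h]
    push_cast
    linear_combination ih + 2 * (2 - α) * sum_grunwaldW_mul hα0 hα1 N -
      (2 * ((N : ℝ) + 1) - α) * grunwaldSum_succ hα0 hα1 N

theorem prod_eq_grunwaldSum {α : ℝ} (hα0 : 0 < α) (hα1 : α < 1) (N : ℕ) :
    ∏ j ∈ range N, (1 - α + j) = N.factorial * grunwaldSum α N := by
  induction N with
  | zero => simp [grunwaldSum_zero hα0]
  | succ N ih =>
    rw [prod_range_succ, ih, Nat.factorial_succ]
    push_cast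
    linear_combination -(N.factorial : ℝ) * grunwaldSum_succ hα0 hα1 N

theorem tendsto_grunwaldSum_mul_rpow {α : ℝ} (hα0 : 0 < α) (hα1 : α < 1) :
    Tendsto (fun N : ℕ => grunwaldSum α N * ((N : ℝ) + (1 - α) / 2) ^ α) atTop
      (𝓝 (1 / Real.Gamma (1 - α))) := by
  have hG := (Real.Gamma_pos_of_pos (by linarith : 0 < 1 - α)).ne'
  rw [← tendsto_add_atTop_iff_nat 1]
  have h1 := (Real.GammaSeq_tendsto_Gamma (1 - α)).inv₀ hG
  have hinv : Tendsto (fun n : ℕ => (1 + (1 - α) / 2 : ℝ) / n) atTop (𝓝 0) :=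
    tendsto_const_div_atTop_nhds_zero_nat _
  have hinv' : Tendsto (fun n : ℕ => (1 : ℝ) / n) atTop (𝓝 0) :=
    tendsto_const_div_atTop_nhds_zero_nat _
  have h2 : Tendsto (fun n : ℕ => (1 + (1 + (1 - α) / 2 : ℝ) / n) ^ α) atTop (𝓝 1) := by
    have := (hinv.const_add 1).rpow_const (p := α) (Or.inr hα0.le)
    simpa using this
  have h3 : Tendsto (fun n : ℕ => (1 + (1 : ℝ) / n)⁻¹) atTop (𝓝 1) := by
    have := (hinv'.const_add 1).inv₀ (by norm_num)
    simpa using this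
  have h4 := (h1.mul h2).mul h3
  simp only [mul_one] at h4
  rw [one_div]
  refine h4.congr' ?_
  filter_upwards [eventually_ge_atTop 1] with n hn
  have hn0 : (0 : ℝ) < n := by exact_mod_cast hn
  have hf : (n.factorial : ℝ) ≠ 0 := by positivity
  rw [Real.GammaSeq, prod_eq_grunwaldSum hα0 hα1, Nat.factorial_succ]
  have e : (((n + 1 : ℕ) : ℝ) + (1 - α) / 2) = n * (1 + (1 + (1 - α) / 2) / n) := by
    push_cast; field_simp; ring
  rw [e, Real.mul_rpow hn0.le (by have : 0 < 1 - α := by linarith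
                                  positivity), Real.rpow_sub hn0, Real.rpow_one]
  have : (n : ℝ) ^ α ≠ 0 := by positivity
  push_cast
  field_simp

theorem abs_log_one_add_sub_log_one_sub_le {t : ℝ} (h0 : 0 ≤ t) (h1 : t ≤ 1 / 2) :
    |Real.log (1 + t) - Real.log (1 - t) - 2 * t| ≤ 4 * t ^ 3 := by
  have ha : |t| = t := abs_of_nonneg h0
  have b1 := Real.abs_log_sub_add_sum_range_le (x := t) (by rw [ha]; linarith) 2
  have b2 := Real.abs_log_sub_add_sum_range_le (x := -t) (by rw [abs_neg, ha]; linarith) 2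
  rw [abs_neg] at b2
  rw [ha] at b1 b2
  have hb : t ^ (2 + 1) / (1 - t) ≤ 2 * t ^ 3 := by
    rw [div_le_iff₀ (by linarith)]
    have : 0 ≤ t ^ 3 * (1 / 2 - t) := mul_nonneg (by positivity) (by linarith)
    have e : 2 * t ^ 3 * (1 - t) = t ^ (2 + 1) + 2 * (t ^ 3 * (1 / 2 - t)) := by ring
    rw [e]
    exact le_add_of_nonneg_right (by positivity)
  simp only [sum_range_succ, range_zero, sum_empty, sub_neg_eq_add] at b1 b2
  norm_num at b1 b2 hb
  rw [abs_le] at *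
  constructor <;> nlinarith

theorem abs_log_grunwaldSum_succ_sub_le {α : ℝ} (hα0 : 0 < α) (hα1 : α < 1) {N : ℕ} (hN : 1 ≤ N) :
    |Real.log (grunwaldSum α (N + 1) * (((N + 1 : ℕ) : ℝ) + (1 - α) / 2) ^ α) -
      Real.log (grunwaldSum α N * ((N : ℝ) + (1 - α) / 2) ^ α)| ≤
      1 / 2 / (N : ℝ) ^ 2 - 1 / 2 / ((N + 1 : ℕ) : ℝ) ^ 2 := by
  have hN' : (1 : ℝ) ≤ N := by exact_mod_cast hN
  have hs0 := grunwaldSum_pos hα0 hα1 N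
  have hs1 : grunwaldSum α (N + 1) = (N + 1 - α) / (N + 1) * grunwaldSum α N := by
    have := grunwaldSum_succ hα0 hα1 N
    field_simp
    linarith
  obtain ⟨m, hm⟩ : ∃ m : ℝ, m = N + 1 - α / 2 := ⟨_, rfl⟩
  have hm1 : (N : ℝ) + 1 / 2 ≤ m := by linarith
  have hmp : 0 < m := by linarith
  obtain ⟨t, ht⟩ : ∃ t : ℝ, t = 1 / (2 * m) := ⟨_, rfl⟩
  have ht0 : 0 < t := by rw [ht]; positivity
  have ht1 : t ≤ 1 / 2 := by
    rw [ht, div_le_div_iff₀ (by positivity) (by positivity)]; linarith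
  have hat : α * t ≤ t := by nlinarith
  have hat0 : 0 < α * t := by positivity
  have hmt : m * t = 1 / 2 := by rw [ht]; field_simp
  have e1 : (N : ℝ) + 1 - α = m * (1 - α * t) := by linear_combination -hm + α * hmt
  have e2 : (N : ℝ) + 1 = m * (1 + α * t) := by linear_combination -hm - α * hmt
  have e3 : ((N + 1 : ℕ) : ℝ) + (1 - α) / 2 = m * (1 + t) := by
    push_cast; linear_combination -hm - hmt
  have e4 : (N : ℝ) + (1 - α) / 2 = m * (1 - t) := by linear_combination -hm + hmt
  have p1 : 0 < 1 - α * t := by linarith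
  have p2 : 0 < 1 + α * t := by linarith
  have p3 : 0 < 1 - t := by linarith
  have p4 : 0 < 1 + t := by linarith
  have key : Real.log (grunwaldSum α (N + 1) * (((N + 1 : ℕ) : ℝ) + (1 - α) / 2) ^ α) -
      Real.log (grunwaldSum α N * ((N : ℝ) + (1 - α) / 2) ^ α) =
      α * (Real.log (1 + t) - Real.log (1 - t) - 2 * t) -
        (Real.log (1 + α * t) - Real.log (1 - α * t) - 2 * (α * t)) := by
    rw [hs1, e1, e2, e3, e4, mul_div_mul_left _ _ hmp.ne',
      Real.log_mul (by positivity) (by positivity), Real.log_mul (by positivity) (by positivity),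
      Real.log_mul (by positivity) (by positivity), Real.log_div p1.ne' p2.ne',
      Real.log_rpow (by positivity), Real.log_rpow (by positivity),
      Real.log_mul hmp.ne' p3.ne', Real.log_mul hmp.ne' p4.ne']
    ring
  have b1 := abs_log_one_add_sub_log_one_sub_le ht0.le ht1
  have b2 := abs_log_one_add_sub_log_one_sub_le hat0.le (hat.trans ht1)
  have b3 : (α * t) ^ 3 ≤ t ^ 3 := by gcongr
  have ht3 : 8 * t ^ 3 = 1 / m ^ 3 := by rw [ht]; field_simp; norm_num
  have b4 : 1 / m ^ 3 ≤ 1 / ((N : ℝ) + 1 / 2) ^ 3 := by gcongr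
  have b5 : 1 / ((N : ℝ) + 1 / 2) ^ 3 ≤ 1 / 2 / (N : ℝ) ^ 2 - 1 / 2 / ((N + 1 : ℕ) : ℝ) ^ 2 := by
    have : 1 / 2 / (N : ℝ) ^ 2 - 1 / 2 / ((N + 1 : ℕ) : ℝ) ^ 2 =
        ((N : ℝ) + 1 / 2) / ((N : ℝ) * (N + 1)) ^ 2 := by
      push_cast; field_simp; ring
    rw [this, div_le_div_iff₀ (by positivity) (by positivity)]
    have : (N : ℝ) * (N + 1) ≤ (N + 1 / 2) ^ 2 := by nlinarith
    calc 1 * ((N : ℝ) * (N + 1)) ^ 2 ≤ 1 * ((N + 1 / 2) ^ 2) ^ 2 := by gcongr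
      _ = _ := by ring
  rw [key]
  have b6 : |α * (Real.log (1 + t) - Real.log (1 - t) - 2 * t)| ≤ 4 * t ^ 3 := by
    rw [abs_mul, abs_of_pos hα0]
    calc _ ≤ 1 * |Real.log (1 + t) - Real.log (1 - t) - 2 * t| := by gcongr
      _ ≤ _ := by linarith
  refine (abs_sub _ _).trans ?_
  linarith

theorem abs_grunwaldSum_mul_sub_one_le {α : ℝ} (hα0 : 0 < α) (hα1 : α < 1) {N : ℕ} (hN : 1 ≤ N) :
    |grunwaldSum α N * Real.Gamma (1 - α) * ((N : ℝ) + (1 - α) / 2) ^ α - 1| ≤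
      1 / (N : ℝ) ^ 2 := by
  have hG := Real.Gamma_pos_of_pos (by linarith : 0 < 1 - α)
  set u : ℕ → ℝ := fun N => Real.log (grunwaldSum α N * ((N : ℝ) + (1 - α) / 2) ^ α) with hu
  set e : ℕ → ℝ := fun N => 1 / 2 / (N : ℝ) ^ 2 with he
  have hlim : Tendsto u atTop (𝓝 (Real.log (1 / Real.Gamma (1 - α)))) :=
    (Real.continuousAt_log (by positivity)).tendsto.comp (tendsto_grunwaldSum_mul_rpow hα0 hα1)
  have helim : Tendsto e atTop (𝓝 0) := by
    have : Tendsto (fun N : ℕ => (N : ℝ) ^ 2) atTop atTop :=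
      (tendsto_pow_atTop two_ne_zero).comp tendsto_natCast_atTop_atTop
    exact this.const_div_atTop _
  have hstep : ∀ n, 1 ≤ n → |u (n + 1) - u n| ≤ e n - e (n + 1) := fun n hn =>
    abs_log_grunwaldSum_succ_sub_le hα0 hα1 hn
  have hmono : ∀ k, u N - e N ≤ u (N + k) - e (N + k) ∧ u (N + k) + e (N + k) ≤ u N + e N := by
    intro k
    induction k with
    | zero => simp
    | succ k ih =>
      have := abs_le.1 (hstep (N + k) (by omega))
      rw [← add_assoc]
      constructor <;> linarith [this.1, this.2, ih.1, ih.2]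
  have l1 : u N - e N ≤ Real.log (1 / Real.Gamma (1 - α)) := by
    have h := (hlim.sub helim).comp (tendsto_add_atTop_nat N)
    rw [sub_zero] at h
    refine ge_of_tendsto' h fun k => ?_
    simpa [add_comm] using (hmono k).1
  have l2 : Real.log (1 / Real.Gamma (1 - α)) ≤ u N + e N := by
    have h := (hlim.add helim).comp (tendsto_add_atTop_nat N)
    rw [add_zero] at h
    refine le_of_tendsto' h fun k => ?_
    simpa [add_comm] using (hmono k).2
  have hN' : (1 : ℝ) ≤ N := by exact_mod_cast hN
  have hbase : 0 < (N : ℝ) + (1 - α) / 2 := by linarith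
  have hs := grunwaldSum_pos hα0 hα1 N
  have hr : grunwaldSum α N * Real.Gamma (1 - α) * ((N : ℝ) + (1 - α) / 2) ^ α =
      Real.exp (u N - Real.log (1 / Real.Gamma (1 - α))) := by
    rw [Real.exp_sub, Real.exp_log (by positivity), Real.exp_log (by positivity)]
    field_simp
  have habs : |u N - Real.log (1 / Real.Gamma (1 - α))| ≤ 1 / 2 / (N : ℝ) ^ 2 := by
    rw [abs_le]; constructor <;> simp only [he] at * <;> linarith
  have hone : 1 / 2 / (N : ℝ) ^ 2 ≤ 1 := by
    rw [div_le_one (by positivity)]; nlinarith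
  rw [hr]
  refine (Real.abs_exp_sub_one_le (habs.trans hone)).trans ?_
  calc _ ≤ 2 * (1 / 2 / (N : ℝ) ^ 2) := by gcongr
    _ = _ := by ring

theorem one_add_mul_sub_rpow_one_add_mem {p x : ℝ} (hp0 : 0 ≤ p) (hp1 : p ≤ 1) (hx : |x| ≤ 1 / 2) :
    0 ≤ 1 + p * x - (1 + x) ^ p ∧ 1 + p * x - (1 + x) ^ p ≤ 2 * x ^ 2 := by
  obtain ⟨hx1, hx2⟩ := abs_le.1 hx
  have b1 := rpow_one_add_le_one_add_mul_self (by linarith : -1 ≤ x) hp0 hp1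
  have b2 := rpow_one_add_le_one_add_mul_self (by linarith : -1 ≤ x) (sub_nonneg.2 hp1)
    (by linarith)
  have hprod : (1 + x) ^ p * (1 + x) ^ (1 - p) = 1 + x := by
    rw [← Real.rpow_add (by linarith)]; simp
  have hpos : 0 < (1 + x) ^ p := Real.rpow_pos_of_pos (by linarith) _
  refine ⟨by linarith, ?_⟩
  have hq : 1 / 2 ≤ 1 + (1 - p) * x := by nlinarith
  have h3 : 1 + x ≤ (1 + x) ^ p * (1 + (1 - p) * x) := by
    calc 1 + x = (1 + x) ^ p * (1 + x) ^ (1 - p) := hprod.symm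
      _ ≤ _ := by gcongr
  have h4 : (1 + p * x - (1 + x) ^ p) * (1 + (1 - p) * x) ≤ p * (1 - p) * x ^ 2 := by nlinarith
  have h5 : p * (1 - p) ≤ 1 := by nlinarith
  nlinarith [sq_nonneg x]

theorem exists_grunwaldSum_eq {α : ℝ} (hα0 : 0 < α) (hα1 : α < 1) {N : ℕ} (hN : 1 ≤ N) :
    ∃ r : ℝ, |r - 1| ≤ 1 / (N : ℝ) ^ 2 ∧
      grunwaldSum α N * Real.Gamma (1 - α) = r * ((N : ℝ) + (1 - α) / 2) ^ (-α) := by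
  refine ⟨_, abs_grunwaldSum_mul_sub_one_le hα0 hα1 hN, ?_⟩
  have hbase : 0 < (N : ℝ) + (1 - α) / 2 := by
    have : (0 : ℝ) ≤ N := N.cast_nonneg
    linarith
  rw [Real.rpow_neg hbase.le, mul_inv_cancel_right₀ (Real.rpow_pos_of_pos hbase α).ne']

theorem rpow_le_two_mul_rpow_of_le_two_mul {a b p : ℝ} (ha : 0 < a) (hb : 0 < b) (hab : a ≤ 2 * b)
    (hp0 : 0 ≤ p) (hp1 : p ≤ 1) : a ^ p ≤ 2 * b ^ p := by
  calc a ^ p ≤ (2 * b) ^ p := by gcongr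
    _ = 2 ^ p * b ^ p := Real.mul_rpow two_pos.le hb.le
    _ ≤ 2 ^ (1 : ℝ) * b ^ p := by gcongr; norm_num
    _ = 2 * b ^ p := by rw [Real.rpow_one]

theorem abs_sum_grunwaldW_mul_sub_rpow_le {α : ℝ} (hα0 : 0 < α) (hα1 : α < 1) {τ : ℝ} (hτ : 1 ≤ τ) :
    |Real.Gamma (1 - α) * (1 - α) * ∑ n ∈ range (⌊τ⌋₊ + 1), grunwaldW α n * (τ - n) -
      (τ - α / 2) ^ (1 - α)| ≤ 32 * τ ^ (-1 - α) := by
  obtain ⟨N, hNdef⟩ : ∃ N, N = ⌊τ⌋₊ := ⟨_, rfl⟩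
  have hN : 1 ≤ N := hNdef ▸ Nat.le_floor (by simpa using hτ)
  have hNτ : (N : ℝ) ≤ τ := hNdef ▸ Nat.floor_le (by linarith)
  have hτN : τ < N + 1 := hNdef ▸ Nat.lt_floor_add_one τ
  rw [← hNdef]
  have hN' : (1 : ℝ) ≤ N := by exact_mod_cast hN
  obtain ⟨r, hr, hs⟩ := exists_grunwaldSum_eq hα0 hα1 hN
  obtain ⟨M, hM⟩ : ∃ M : ℝ, M = N + (1 - α) / 2 := ⟨_, rfl⟩
  rw [← hM] at hs
  have hM0 : 0 < M := by linarith
  obtain ⟨x, hx⟩ : ∃ x : ℝ, x = (τ - N - 1 / 2) / M := ⟨_, rfl⟩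
  have hMx : M * x = τ - N - 1 / 2 := by rw [hx]; field_simp
  have hxN : |x| ≤ 1 / (2 * N) := by
    rw [hx, abs_div, abs_of_pos hM0, div_le_div_iff₀ hM0 (by positivity)]
    have : |τ - N - 1 / 2| ≤ 1 / 2 := abs_le.2 ⟨by linarith, by linarith⟩
    nlinarith
  have hx2 : |x| ≤ 1 / 2 := hxN.trans <| by gcongr; linarith
  obtain ⟨hx3, hx4⟩ := abs_le.1 hx2
  obtain ⟨e0, e1⟩ := one_add_mul_sub_rpow_one_add_mem (p := 1 - α) (by linarith) (by linarith) hx2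
  have hsum : ∑ n ∈ range (N + 1), grunwaldW α n * (τ - n) =
      ∑ n ∈ range (N + 1), grunwaldW α n * ((N : ℝ) - n) + (τ - N) * grunwaldSum α N := by
    rw [grunwaldSum, mul_sum, ← sum_add_distrib]
    exact sum_congr rfl fun n _ => by ring
  have hpow : M ^ (1 - α) = M * M ^ (-α) := by
    rw [sub_eq_add_neg, Real.rpow_add hM0, Real.rpow_one]
  have hmain : Real.Gamma (1 - α) * (1 - α) * ∑ n ∈ range (N + 1), grunwaldW α n * (τ - n) -
      (τ - α / 2) ^ (1 - α) = M ^ (1 - α) *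
        ((r - 1) * (1 + (1 - α) * x) + (1 + (1 - α) * x - (1 + x) ^ (1 - α))) := by
    have h1 : τ - α / 2 = M * (1 + x) := by linear_combination -hM - hMx
    rw [hsum, h1, Real.mul_rpow hM0.le (by linarith), hpow]
    linear_combination Real.Gamma (1 - α) * sum_grunwaldW_mul hα0 hα1 N +
      (N + (1 - α) * (τ - N)) * hs - r * M ^ (-α) * hM - r * M ^ (-α) * (1 - α) * hMx
  rw [hmain, abs_mul, abs_of_pos (by positivity)]
  have hxx : x ^ 2 ≤ 1 / 4 * (1 / (N : ℝ) ^ 2) := by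
    rw [← sq_abs]
    calc |x| ^ 2 ≤ (1 / (2 * N)) ^ 2 := by gcongr
      _ = _ := by field_simp; norm_num
  have hb1 : |1 + (1 - α) * x| ≤ 2 := abs_le.2 ⟨by nlinarith, by nlinarith⟩
  have hb : |(r - 1) * (1 + (1 - α) * x) + (1 + (1 - α) * x - (1 + x) ^ (1 - α))| ≤
      4 * (1 / (N : ℝ) ^ 2) := by
    refine (abs_add_le _ _).trans ?_
    rw [abs_mul, abs_of_nonneg e0]
    have : |r - 1| * |1 + (1 - α) * x| ≤ 1 / (N : ℝ) ^ 2 * 2 := by gcongr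
    have : 0 ≤ 1 / (N : ℝ) ^ 2 := by positivity
    linarith
  have hτ0 : 0 < τ := by linarith
  have hNinv : 1 / (N : ℝ) ^ 2 ≤ 4 * (1 / τ ^ 2) := by
    calc 1 / (N : ℝ) ^ 2 ≤ 1 / (τ / 2) ^ 2 := by gcongr; linarith
      _ = _ := by field_simp; norm_num
  have hMτ := rpow_le_two_mul_rpow_of_le_two_mul (p := 1 - α) hM0 hτ0 (by linarith) (by linarith)
    (by linarith)
  have hτpow : τ ^ (-1 - α) = τ ^ (1 - α) * (1 / τ ^ 2) := by
    rw [show -1 - α = (1 - α) - (2 : ℕ) by push_cast; ring, Real.rpow_sub_natCast hτ0.ne']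
    ring
  calc _ ≤ (2 * τ ^ (1 - α)) * (4 * (4 * (1 / τ ^ 2))) := by
        gcongr
        exact hb.trans (by gcongr)
    _ = _ := by rw [hτpow]; ring

theorem abs_sum_grunwaldW_mul_sq_sub_rpow_le {α : ℝ} (hα0 : 0 < α) (hα1 : α < 1) {τ : ℝ}
    (hτ : 1 ≤ τ) :
    |Real.Gamma (1 - α) * (1 - α) * (2 - α) *
        ∑ n ∈ range (⌊τ⌋₊ + 1), grunwaldW α n * ((τ - n) ^ 2 / 2) -
      (τ - α / 2) ^ (2 - α)| ≤ 30 * τ ^ (-α) := by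
  obtain ⟨N, hNdef⟩ : ∃ N, N = ⌊τ⌋₊ := ⟨_, rfl⟩
  have hN : 1 ≤ N := hNdef ▸ Nat.le_floor (by simpa using hτ)
  have hNτ : (N : ℝ) ≤ τ := hNdef ▸ Nat.floor_le (by linarith)
  have hτN : τ < N + 1 := hNdef ▸ Nat.lt_floor_add_one τ
  rw [← hNdef]
  have hN' : (1 : ℝ) ≤ N := by exact_mod_cast hN
  obtain ⟨r, hr, hs⟩ := exists_grunwaldSum_eq hα0 hα1 hN
  obtain ⟨M, hM⟩ : ∃ M : ℝ, M = N + (1 - α) / 2 := ⟨_, rfl⟩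
  rw [← hM] at hs
  have hM0 : 0 < M := by linarith
  obtain ⟨θ, hθ⟩ : ∃ θ : ℝ, θ = τ - N := ⟨_, rfl⟩
  have hθ0 : 0 ≤ θ := by linarith
  have hθ1 : θ ≤ 1 := by linarith
  obtain ⟨x, hx⟩ : ∃ x : ℝ, x = (θ - 1 / 2) / M := ⟨_, rfl⟩
  have hMx : M * x = θ - 1 / 2 := by rw [hx]; field_simp
  have hθa : |θ - 1 / 2| ≤ 1 / 2 := abs_le.2 ⟨by linarith, by linarith⟩
  have hx2 : |x| ≤ 1 / 2 := by
    rw [hx, abs_div, abs_of_pos hM0, div_le_iff₀ hM0]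
    nlinarith
  obtain ⟨hx3, hx4⟩ := abs_le.1 hx2
  obtain ⟨e0, e1⟩ := one_add_mul_sub_rpow_one_add_mem (p := 1 - α) (by linarith) (by linarith) hx2
  have hsum : ∑ n ∈ range (N + 1), grunwaldW α n * ((τ - n) ^ 2 / 2) =
      1 / 2 * ∑ n ∈ range (N + 1), grunwaldW α n * ((N : ℝ) - n) ^ 2 +
      θ * ∑ n ∈ range (N + 1), grunwaldW α n * ((N : ℝ) - n) + θ ^ 2 / 2 * grunwaldSum α N := by
    rw [grunwaldSum, mul_sum, mul_sum, mul_sum, ← sum_add_distrib, ← sum_add_distrib]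
    exact sum_congr rfl fun n _ => by rw [hθ]; ring
  obtain ⟨A, hA⟩ : ∃ A : ℝ, A = N * (2 * N - α) / 2 + (2 - α) * θ * N +
      (1 - α) * (2 - α) * θ ^ 2 / 2 := ⟨_, rfl⟩
  have hpow : M ^ (2 - α) = M ^ 2 * M ^ (-α) := by
    rw [sub_eq_add_neg, Real.rpow_add hM0, Real.rpow_two]
  have hxpow : (1 + x) ^ (2 - α) = (1 + x) * (1 + x) ^ (1 - α) := by
    rw [show 2 - α = 1 + (1 - α) by ring, Real.rpow_add (by linarith), Real.rpow_one]
  have hmain : Real.Gamma (1 - α) * (1 - α) * (2 - α) *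
        ∑ n ∈ range (N + 1), grunwaldW α n * ((τ - n) ^ 2 / 2) - (τ - α / 2) ^ (2 - α) =
      M ^ (-α) * ((r - 1) * A + (A - (M + (θ - 1 / 2)) * (M + (1 - α) * (θ - 1 / 2))) +
        M ^ 2 * (1 + x) * (1 + (1 - α) * x - (1 + x) ^ (1 - α))) := by
    have h1 : τ - α / 2 = M * (1 + x) := by linear_combination -hM - hMx - hθ
    rw [hsum, h1, Real.mul_rpow hM0.le (by linarith), hpow, hxpow, ← hMx, hA]
    linear_combination Real.Gamma (1 - α) / 2 * sum_grunwaldW_mul_sq hα0 hα1 N +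
      θ * Real.Gamma (1 - α) * (2 - α) * sum_grunwaldW_mul hα0 hα1 N +
      (N * (2 * N - α) / 2 + (2 - α) * θ * N + (1 - α) * (2 - α) * θ ^ 2 / 2) * hs
  have hb1 : |(r - 1) * A| ≤ 8 := by
    have hA0 : 0 ≤ A := by
      rw [hA]
      have : 0 ≤ 2 * (N : ℝ) - α := by linarith
      have : 0 ≤ 2 - α := by linarith
      have : 0 ≤ 1 - α := by linarith
      positivity
    have hA1 : A ≤ 4 * (N : ℝ) ^ 2 := by
      have h1 : (2 - α) * θ * N ≤ 2 * 1 * N := by gcongr; linarith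
      have h2 : (1 - α) * (2 - α) * θ ^ 2 / 2 ≤ 1 * 2 * 1 ^ 2 / 2 := by
        gcongr <;> linarith
      rw [hA]
      nlinarith
    rw [abs_mul, abs_of_nonneg hA0]
    calc |r - 1| * A ≤ 1 / (N : ℝ) ^ 2 * (4 * (N : ℝ) ^ 2) := by gcongr
      _ = 4 := by field_simp
      _ ≤ 8 := by norm_num
  have hb2 : |A - (M + (θ - 1 / 2)) * (M + (1 - α) * (θ - 1 / 2))| ≤ 4 := by
    have : A - (M + (θ - 1 / 2)) * (M + (1 - α) * (θ - 1 / 2)) =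
        α * (1 - α) * θ * (1 - θ) / 2 := by
      rw [hA, hM]; ring
    have h0 : 0 ≤ 1 - α := by linarith
    have h1 : 0 ≤ 1 - θ := by linarith
    rw [this, abs_of_nonneg (by positivity)]
    calc α * (1 - α) * θ * (1 - θ) / 2 ≤ 1 * 1 * 1 * 1 / 2 := by gcongr <;> linarith
      _ ≤ 4 := by norm_num
  have hb3 : |M ^ 2 * (1 + x) * (1 + (1 - α) * x - (1 + x) ^ (1 - α))| ≤ 1 := by
    rw [abs_of_nonneg (mul_nonneg (mul_nonneg (by positivity) (by linarith)) e0)]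
    have h1 : (M * x) ^ 2 ≤ (1 / 2) ^ 2 := by
      rw [hMx, ← sq_abs]; gcongr
    calc _ ≤ M ^ 2 * 2 * (2 * x ^ 2) := by gcongr; linarith
      _ = 4 * (M * x) ^ 2 := by ring
      _ ≤ 1 := by linarith
  have hτ0 : 0 < τ := by linarith
  have hMτ : M ^ (-α) ≤ 2 * τ ^ (-α) := by
    have := rpow_le_two_mul_rpow_of_le_two_mul (p := α) hτ0 hM0 (by linarith) hα0.le hα1.le
    rw [Real.rpow_neg hM0.le, Real.rpow_neg hτ0.le, ← div_eq_mul_inv, ← one_div,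
      div_le_div_iff₀ (by positivity) (by positivity)]
    linarith
  rw [hmain, abs_mul, abs_of_pos (by positivity)]
  calc _ ≤ (2 * τ ^ (-α)) * (8 + 4 + 1) := by
        gcongr
        exact (abs_add_le _ _).trans (add_le_add ((abs_add_le _ _).trans (add_le_add hb1 hb2)) hb3)
    _ ≤ _ := by
      have : 0 < τ ^ (-α) := by positivity
      linarith

theorem abs_sum_grunwaldW_mul_max_sq_sub_rpow_le {α : ℝ} (hα0 : 0 < α) (hα1 : α < 1) {τ : ℝ}
    (hτ : 0 < τ) {K : ℕ} (hK : τ < K + 1) :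
    |Real.Gamma (1 - α) * (1 - α) * (2 - α) *
        ∑ n ∈ range (K + 1), grunwaldW α n * (max (τ - n) 0 ^ 2 / 2) -
      max (τ - α / 2) 0 ^ (2 - α)| ≤
      (30 + Real.Gamma (1 - α) * (1 - α) * (2 - α)) * τ ^ (-α) := by
  have hG := Real.Gamma_pos_of_pos (by linarith : 0 < 1 - α)
  have hα1' : 0 < 1 - α := by linarith
  have hα2' : 0 < 2 - α := by linarith
  have hsum : ∑ n ∈ range (K + 1), grunwaldW α n * (max (τ - n) 0 ^ 2 / 2) =
      ∑ n ∈ range (⌊τ⌋₊ + 1), grunwaldW α n * ((τ - n) ^ 2 / 2) := by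
    have hle : ⌊τ⌋₊ + 1 ≤ K + 1 := by
      have : ⌊τ⌋₊ < K + 1 := (Nat.floor_lt hτ.le).2 (by exact_mod_cast hK)
      omega
    rw [← sum_subset (range_subset_range.2 hle)]
    · refine sum_congr rfl fun n hn => ?_
      have : (n : ℝ) ≤ τ := (Nat.le_floor_iff hτ.le).1 (by simpa [Nat.lt_succ_iff] using hn)
      rw [max_eq_left (by linarith)]
    · intro n _ hn
      have : τ < n := (Nat.floor_lt hτ.le).1 (by simp at hn; omega)
      rw [max_eq_right (by linarith)]
      simp
  rw [hsum]
  have hpos : 0 < τ ^ (-α) := by positivity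
  rcases le_or_gt 1 τ with h1 | h1
  · rw [max_eq_left (by linarith)]
    refine (abs_sum_grunwaldW_mul_sq_sub_rpow_le hα0 hα1 h1).trans ?_
    gcongr
    have : 0 ≤ Real.Gamma (1 - α) * (1 - α) * (2 - α) := by positivity
    linarith
  · have hfl : ⌊τ⌋₊ = 0 := Nat.floor_eq_zero.2 h1
    have hone : 1 ≤ τ ^ (-α) :=
      Real.one_le_rpow_of_pos_of_le_one_of_nonpos hτ h1.le (by linarith)
    simp only [hfl, zero_add, range_one, sum_singleton, grunwaldW_zero hα0, Nat.cast_zero, sub_zero,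
      one_mul]
    have hm0 : 0 ≤ max (τ - α / 2) 0 := le_max_right _ _
    have hm : max (τ - α / 2) 0 ^ (2 - α) ≤ 1 :=
      Real.rpow_le_one hm0 (max_le (by linarith) zero_le_one) hα2'.le
    have hm' : 0 ≤ max (τ - α / 2) 0 ^ (2 - α) := by positivity
    have hτ2 : τ ^ 2 / 2 ≤ 1 := by nlinarith
    have hc : Real.Gamma (1 - α) * (1 - α) * (2 - α) * (τ ^ 2 / 2) ≤
        Real.Gamma (1 - α) * (1 - α) * (2 - α) * 1 := by gcongr
    have hc0 : 0 ≤ Real.Gamma (1 - α) * (1 - α) * (2 - α) * (τ ^ 2 / 2) := by positivity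
    calc _ ≤ (30 + Real.Gamma (1 - α) * (1 - α) * (2 - α)) * 1 :=
          abs_le.2 ⟨by linarith, by linarith⟩
      _ ≤ _ := by gcongr

theorem abs_scaled_sum_grunwaldW_mul_sub_rpow_le {α : ℝ} (hα0 : 0 < α) (hα1 : α < 1) {h t : ℝ}
    (hh : 0 < h) (ht : h ≤ t) :
    |Real.Gamma (1 - α) * (1 - α) *
        (h ^ (-α) * ∑ n ∈ range (⌊t / h⌋₊ + 1), grunwaldW α n * (t - n * h)) -
      (t - α * h / 2) ^ (1 - α)| ≤ 32 * t ^ (-1 - α) * h ^ 2 := by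
  have hτ : 1 ≤ t / h := (one_le_div hh).2 ht
  have key := abs_sum_grunwaldW_mul_sub_rpow_le hα0 hα1 hτ
  have hp : 0 < h ^ (1 - α) := by positivity
  have hpow : h ^ (1 - α) = h * h ^ (-α) := by
    rw [sub_eq_add_neg, Real.rpow_add hh, Real.rpow_one]
  have e1 : (t - α * h / 2) ^ (1 - α) = h ^ (1 - α) * (t / h - α / 2) ^ (1 - α) := by
    rw [← Real.mul_rpow hh.le (by linarith)]
    congr 1
    field_simp
  have e2 : ∑ n ∈ range (⌊t / h⌋₊ + 1), grunwaldW α n * (t - n * h) =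
      h * ∑ n ∈ range (⌊t / h⌋₊ + 1), grunwaldW α n * (t / h - n) := by
    rw [mul_sum]
    exact sum_congr rfl fun n _ => by field_simp
  have e3 : h ^ (1 - α) * (t / h) ^ (-1 - α) = t ^ (-1 - α) * h ^ 2 := by
    rw [Real.div_rpow (by linarith) hh.le, show 1 - α = (-1 - α) + (2 : ℕ) by push_cast; ring,
      Real.rpow_add_natCast hh.ne']
    have := (Real.rpow_pos_of_pos hh (-1 - α)).ne'
    field_simp
  calc _ = |h ^ (1 - α) * (Real.Gamma (1 - α) * (1 - α) *
          ∑ n ∈ range (⌊t / h⌋₊ + 1), grunwaldW α n * (t / h - n) -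
        (t / h - α / 2) ^ (1 - α))| := by
        rw [e1, e2, hpow]; congr 1; ring
    _ ≤ h ^ (1 - α) * (32 * (t / h) ^ (-1 - α)) := by
        rw [abs_mul, abs_of_pos hp]; gcongr
    _ = _ := by linear_combination 32 * e3

theorem abs_scaled_sum_grunwaldW_mul_max_sq_sub_rpow_le {α : ℝ} (hα0 : 0 < α) (hα1 : α < 1)
    {h t : ℝ} (hh : 0 < h) (ht : 0 < t) {K : ℕ} (hK : t / h < K + 1) :
    |Real.Gamma (1 - α) * (1 - α) * (2 - α) *
        (h ^ (-α) * ∑ n ∈ range (K + 1), grunwaldW α n * (max (t - n * h) 0 ^ 2 / 2)) -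
      max (t - α * h / 2) 0 ^ (2 - α)| ≤
      (30 + Real.Gamma (1 - α) * (1 - α) * (2 - α)) * h ^ 2 * t ^ (-α) := by
  have key := abs_sum_grunwaldW_mul_max_sq_sub_rpow_le hα0 hα1 (div_pos ht hh) hK
  have hp : 0 < h ^ (2 - α) := by positivity
  have hpow : h ^ (2 - α) = h ^ 2 * h ^ (-α) := by
    rw [sub_eq_add_neg, Real.rpow_add hh, Real.rpow_two]
  have hmax : ∀ a : ℝ, max (t - a * h) 0 = h * max (t / h - a) 0 := by
    intro a
    rw [mul_max_of_nonneg _ _ hh.le, mul_zero]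
    congr 1
    field_simp
  have e1 : max (t - α * h / 2) 0 ^ (2 - α) = h ^ (2 - α) * max (t / h - α / 2) 0 ^ (2 - α) := by
    rw [← Real.mul_rpow hh.le (le_max_right _ _), ← hmax]
    congr 3
    ring
  have e2 : ∑ n ∈ range (K + 1), grunwaldW α n * (max (t - n * h) 0 ^ 2 / 2) =
      h ^ 2 * ∑ n ∈ range (K + 1), grunwaldW α n * (max (t / h - n) 0 ^ 2 / 2) := by
    rw [mul_sum]
    exact sum_congr rfl fun n _ => by rw [hmax]; ring
  have e3 : h ^ (2 - α) * (t / h) ^ (-α) = h ^ 2 * t ^ (-α) := by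
    rw [Real.div_rpow ht.le hh.le, hpow]
    have := (Real.rpow_pos_of_pos hh (-α)).ne'
    field_simp
  calc _ = |h ^ (2 - α) * (Real.Gamma (1 - α) * (1 - α) * (2 - α) *
          ∑ n ∈ range (K + 1), grunwaldW α n * (max (t / h - n) 0 ^ 2 / 2) -
        max (t / h - α / 2) 0 ^ (2 - α))| := by
        rw [e1, e2, hpow]; congr 1; ring
    _ ≤ h ^ (2 - α) * ((30 + Real.Gamma (1 - α) * (1 - α) * (2 - α)) * (t / h) ^ (-α)) := by
        rw [abs_mul, abs_of_pos hp]; gcongr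
    _ = _ := by linear_combination (30 + Real.Gamma (1 - α) * (1 - α) * (2 - α)) * e3

theorem integral_eq_integral_of_eqOn_zero {b z x : ℝ} {f g : ℝ → ℝ} (hbz : b ≤ z) (hzx : z ≤ x)
    (hg : ContinuousOn g (Set.Icc b x)) (h1 : Set.EqOn g f (Set.Ioo b z))
    (h2 : Set.EqOn g 0 (Set.Ioo z x)) : ∫ u in b..x, g u = ∫ u in b..z, f u := by
  have i1 : IntervalIntegrable g volume b z :=
    (hg.mono (Set.Icc_subset_Icc_right hzx)).intervalIntegrable_of_Icc hbz
  have i2 : IntervalIntegrable g volume z x :=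
    (hg.mono (Set.Icc_subset_Icc_left hbz)).intervalIntegrable_of_Icc hzx
  rw [← intervalIntegral.integral_add_adjacent_intervals i1 i2,
    intervalIntegral.integral_congr_Ioo_of_le hbz h1,
    intervalIntegral.integral_congr_Ioo_of_le hzx h2]
  simp

section Kernel

variable {b x : ℝ} {f₀ f₁ f₂ f₃ : ℝ → ℝ}

theorem taylor_kernel_eq
    (c₀ : ContinuousOn f₀ (Set.Icc b x)) (c₁ : ContinuousOn f₁ (Set.Icc b x))
    (c₂ : ContinuousOn f₂ (Set.Icc b x)) (c₃ : ContinuousOn f₃ (Set.Icc b x))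
    (d₀ : ∀ u ∈ Set.Ioo b x, HasDerivAt f₀ (f₁ u) u)
    (d₁ : ∀ u ∈ Set.Ioo b x, HasDerivAt f₁ (f₂ u) u)
    (d₂ : ∀ u ∈ Set.Ioo b x, HasDerivAt f₂ (f₃ u) u) {t : ℝ} (hbt : b ≤ t) (htx : t ≤ x) :
    f₀ t = f₀ b + f₁ b * (t - b) + f₂ b * (max (t - b) 0 ^ 2 / 2) +
      ∫ u in b..x, max (t - u) 0 ^ 2 / 2 * f₃ u := by
  have hsub : Set.Icc b t ⊆ Set.Icc b x := Set.Icc_subset_Icc_right htx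
  rw [integral_eq_integral_of_eqOn_zero (z := t) (f := fun u => (t - u) ^ 2 / 2 * f₃ u) hbt htx
    (by fun_prop)
    (fun u hu => by simp [max_eq_left (sub_nonneg.2 hu.2.le)])
    (fun u hu => by simp [max_eq_right (sub_nonpos.2 hu.1.le)])]
  have := intervalIntegral.integral_eq_sub_of_hasDerivAt_of_le (a := b) (b := t)
    (f := fun u => f₀ u + (t - u) * f₁ u + (t - u) ^ 2 / 2 * f₂ u)
    (f' := fun u => (t - u) ^ 2 / 2 * f₃ u) hbt ?_ ?_ ?_
  · rw [this, max_eq_left (sub_nonneg.2 hbt)]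
    ring
  · have := c₀.mono hsub
    have := c₁.mono hsub
    have := c₂.mono hsub
    fun_prop
  · intro u hu
    have hu' : u ∈ Set.Ioo b x := ⟨hu.1, hu.2.trans_le htx⟩
    have hl : HasDerivAt (fun u => t - u) (-1) u := by
      simpa using (hasDerivAt_id u).const_sub t
    refine (((d₀ u hu').add (hl.mul (d₁ u hu'))).add
      (((hl.pow 2).div_const 2).mul (d₂ u hu'))).congr_deriv ?_
    simp
    ring
  · refine ContinuousOn.intervalIntegrable_of_Icc hbt ?_
    have := c₃.mono hsub
    fun_prop

theorem caputo_kernel_eq {α : ℝ} (hα1 : α < 1)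
    (c₁ : ContinuousOn f₁ (Set.Icc b x))
    (c₂ : ContinuousOn f₂ (Set.Icc b x)) (c₃ : ContinuousOn f₃ (Set.Icc b x))
    (d₀ : ∀ u ∈ Set.Ioo b x, HasDerivAt f₀ (f₁ u) u)
    (d₁ : ∀ u ∈ Set.Ioo b x, HasDerivAt f₁ (f₂ u) u)
    (d₂ : ∀ u ∈ Set.Ioo b x, HasDerivAt f₂ (f₃ u) u) {z : ℝ} (hbz : b ≤ z) (hzx : z ≤ x) :
    Real.Gamma (1 - α) * (1 - α) * (2 - α) * caputo α b f₀ z =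
      (2 - α) * f₁ b * (z - b) ^ (1 - α) + f₂ b * max (z - b) 0 ^ (2 - α) +
      ∫ u in b..x, max (z - u) 0 ^ (2 - α) * f₃ u := by
  have hsub : Set.Icc b z ⊆ Set.Icc b x := Set.Icc_subset_Icc_right hzx
  have h1 : 0 < 1 - α := by linarith
  have h2 : 0 < 2 - α := by linarith
  have hG := (Real.Gamma_pos_of_pos h1).ne'
  have k₁ := c₁.mono hsub
  have k₂ := c₂.mono hsub
  have k₃ := c₃.mono hsub
  have p1 : Continuous fun u : ℝ => (z - u) ^ (1 - α) :=
    (continuous_const.sub continuous_id).rpow_const fun _ => Or.inr h1.le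
  have p2 : Continuous fun u : ℝ => (z - u) ^ (2 - α) :=
    (continuous_const.sub continuous_id).rpow_const fun _ => Or.inr h2.le
  have p3 : Continuous fun u : ℝ => max (z - u) 0 ^ (2 - α) :=
    ((continuous_const.sub continuous_id).max continuous_const).rpow_const fun _ => Or.inr h2.le
  rw [integral_eq_integral_of_eqOn_zero (z := z) (f := fun u => (z - u) ^ (2 - α) * f₃ u)
    (g := fun u => max (z - u) 0 ^ (2 - α) * f₃ u) hbz hzx
    (p3.continuousOn.mul c₃)
    (fun u hu => by simp [max_eq_left (sub_nonneg.2 hu.2.le)])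
    (fun u hu => by simp [max_eq_right (sub_nonpos.2 hu.1.le), Real.zero_rpow h2.ne'])]
  have hcap : Real.Gamma (1 - α) * caputo α b f₀ z = ∫ u in b..z, (z - u) ^ (-α) * f₁ u := by
    rw [caputo, ← mul_assoc, mul_one_div_cancel hG, one_mul]
    refine intervalIntegral.integral_congr_Ioo_of_le hbz fun u hu => ?_
    rw [(d₀ u ⟨hu.1, hu.2.trans_le hzx⟩).deriv, mul_comm]
  have i1 : IntervalIntegrable (fun u => (z - u) ^ (-α) * f₁ u) volume b z := by
    have := (intervalIntegral.intervalIntegrable_rpow' (a := z - b) (b := 0) (r := -α)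
      (by linarith)).comp_sub_left z
    simp only [sub_sub_cancel, sub_zero] at this
    refine this.mul_continuousOn ?_
    rwa [Set.uIcc_of_le hbz]
  have i2 : IntervalIntegrable (fun u => (z - u) ^ (2 - α) * f₃ u) volume b z :=
    (p2.continuousOn.mul k₃).intervalIntegrable_of_Icc hbz
  have key := intervalIntegral.integral_eq_sub_of_hasDerivAt_of_le (a := b) (b := z)
    (f := fun u => (2 - α) * ((z - u) ^ (1 - α) * f₁ u) + (z - u) ^ (2 - α) * f₂ u)
    (f' := fun u => (z - u) ^ (2 - α) * f₃ u - (1 - α) * (2 - α) * ((z - u) ^ (-α) * f₁ u))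
    hbz ?_ ?_ (i2.sub (i1.const_mul _))
  · rw [intervalIntegral.integral_sub i2 (i1.const_mul _), intervalIntegral.integral_const_mul,
      ← hcap] at key
    simp only [sub_self, Real.zero_rpow h1.ne', Real.zero_rpow h2.ne', zero_mul, mul_zero,
      add_zero] at key
    rw [max_eq_left (sub_nonneg.2 hbz)]
    linear_combination -key
  · exact (continuousOn_const.mul (p1.continuousOn.mul k₁)).add (p2.continuousOn.mul k₂)
  · intro u hu
    have hu' : u ∈ Set.Ioo b x := ⟨hu.1, hu.2.trans_le hzx⟩
    have hzu : 0 < z - u := sub_pos.2 hu.2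
    have hl : HasDerivAt (fun u => z - u) (-1) u := by
      simpa using (hasDerivAt_id u).const_sub z
    refine ((((hl.rpow_const (p := 1 - α) (Or.inl hzu.ne')).mul (d₁ u hu')).const_mul (2 - α)).add
      ((hl.rpow_const (p := 2 - α) (Or.inl hzu.ne')).mul (d₂ u hu'))).congr_deriv ?_
    rw [show 1 - α - 1 = -α by ring, show 2 - α - 1 = 1 - α by ring]
    ring

theorem shiftedGrunwald_kernel_eq (α : ℝ)
    (c₀ : ContinuousOn f₀ (Set.Icc b x)) (c₁ : ContinuousOn f₁ (Set.Icc b x))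
    (c₂ : ContinuousOn f₂ (Set.Icc b x)) (c₃ : ContinuousOn f₃ (Set.Icc b x))
    (d₀ : ∀ u ∈ Set.Ioo b x, HasDerivAt f₀ (f₁ u) u)
    (d₁ : ∀ u ∈ Set.Ioo b x, HasDerivAt f₁ (f₂ u) u)
    (d₂ : ∀ u ∈ Set.Ioo b x, HasDerivAt f₂ (f₃ u) u) (hb : f₀ b = 0) (hbx : b ≤ x) {h : ℝ}
    (hh : 0 < h) :
    shiftedGrunwald α b 0 h f₀ x =
      f₁ b * ∑ n ∈ range (⌊(x - b) / h⌋₊ + 1), grunwaldW α n * (x - b - n * h) +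
      f₂ b * ∑ n ∈ range (⌊(x - b) / h⌋₊ + 1), grunwaldW α n * (max (x - b - n * h) 0 ^ 2 / 2) +
      ∫ u in b..x, (∑ n ∈ range (⌊(x - b) / h⌋₊ + 1),
        grunwaldW α n * (max (x - u - n * h) 0 ^ 2 / 2)) * f₃ u := by
  simp only [sum_mul]
  rw [intervalIntegral.integral_finsetSum
    (fun n _ => ContinuousOn.intervalIntegrable_of_Icc hbx (by fun_prop)), shiftedGrunwald, mul_sum,
    mul_sum, ← sum_add_distrib, ← sum_add_distrib]
  refine sum_congr rfl fun n hn => ?_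
  have hn' : (n : ℝ) ≤ (x - b) / h :=
    (Nat.le_floor_iff (div_nonneg (sub_nonneg.2 hbx) hh.le)).1 (by simpa [Nat.lt_succ_iff] using hn)
  rw [le_div_iff₀ hh] at hn'
  have hnh : 0 ≤ (n : ℝ) * h := by positivity
  simp only [mul_assoc, intervalIntegral.integral_const_mul, sub_zero]
  rw [taylor_kernel_eq (t := x - n * h) c₀ c₁ c₂ c₃ d₀ d₁ d₂ (by linarith) (by linarith), hb]
  simp only [sub_right_comm x (n * h)]
  ring

theorem exists_abs_shiftedGrunwald_sub_caputo_le {α : ℝ} (hα0 : 0 < α) (hα1 : α < 1)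
    (c₀ : ContinuousOn f₀ (Set.Icc b x)) (c₁ : ContinuousOn f₁ (Set.Icc b x))
    (c₂ : ContinuousOn f₂ (Set.Icc b x)) (c₃ : ContinuousOn f₃ (Set.Icc b x))
    (d₀ : ∀ u ∈ Set.Ioo b x, HasDerivAt f₀ (f₁ u) u)
    (d₁ : ∀ u ∈ Set.Ioo b x, HasDerivAt f₁ (f₂ u) u)
    (d₂ : ∀ u ∈ Set.Ioo b x, HasDerivAt f₂ (f₃ u) u) (hb : f₀ b = 0) (hbx : b < x) :
    ∃ C : ℝ, ∀ h : ℝ, 0 < h → h < x - b →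
      |h ^ (-α) * shiftedGrunwald α b 0 h f₀ x - caputo α b f₀ (x - α * h / 2)| ≤ C * h ^ 2 := by
  obtain ⟨B, hB⟩ := isCompact_Icc.exists_bound_of_continuousOn c₃
  obtain ⟨c, hc⟩ : ∃ c, c = Real.Gamma (1 - α) * (1 - α) * (2 - α) := ⟨_, rfl⟩
  have h1 : 0 < 1 - α := by linarith
  have h2 : 0 < 2 - α := by linarith
  have hc0 : 0 < c := by
    have := Real.Gamma_pos_of_pos h1
    rw [hc]; positivity
  have hi : IntervalIntegrable (fun u => (x - u) ^ (-α)) volume b x := by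
    have := (intervalIntegral.intervalIntegrable_rpow' (a := x - b) (b := 0) (r := -α)
      (by linarith)).comp_sub_left x
    simpa only [sub_sub_cancel, sub_zero] using this
  refine ⟨(|(2 - α) * f₁ b| * (32 * (x - b) ^ (-1 - α)) + |f₂ b| * ((30 + c) * (x - b) ^ (-α)) +
    (30 + c) * B * ∫ u in b..x, (x - u) ^ (-α)) / c, fun h hh hhx => ?_⟩
  have hz : b ≤ x - α * h / 2 := by nlinarith
  have hzx : x - α * h / 2 ≤ x := by
    have : 0 ≤ α * h / 2 := by positivity
    linarith
  have hxb : 0 < x - b := sub_pos.2 hbx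
  have hcap := caputo_kernel_eq hα1 c₁ c₂ c₃ d₀ d₁ d₂ hz hzx
  have hgr := shiftedGrunwald_kernel_eq α c₀ c₁ c₂ c₃ d₀ d₁ d₂ hb hbx.le hh
  have E1 := abs_scaled_sum_grunwaldW_mul_sub_rpow_le hα0 hα1 hh hhx.le
  obtain ⟨K, hK⟩ : ∃ K, K = ⌊(x - b) / h⌋₊ := ⟨_, rfl⟩
  have hKlt : (x - b) / h < K + 1 := hK ▸ Nat.lt_floor_add_one _
  have E2 := abs_scaled_sum_grunwaldW_mul_max_sq_sub_rpow_le hα0 hα1 hh hxb hKlt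
  rw [← hK] at hgr E1
  rw [← hc] at hcap E2
  obtain ⟨G, hG⟩ : ∃ G : ℝ → ℝ, G = fun u =>
    c * (h ^ (-α) * ∑ n ∈ range (K + 1), grunwaldW α n * (max (x - u - n * h) 0 ^ 2 / 2)) -
      max (x - α * h / 2 - u) 0 ^ (2 - α) := ⟨_, rfl⟩
  have E3 : |∫ u in b..x, G u * f₃ u| ≤ (30 + c) * B * h ^ 2 * ∫ u in b..x, (x - u) ^ (-α) := by
    rw [← intervalIntegral.integral_const_mul, ← Real.norm_eq_abs]
    refine intervalIntegral.norm_integral_le_of_norm_le hbx.le ?_ (hi.const_mul _)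
    filter_upwards [Measure.ae_ne volume x] with u hux hu
    have hux' : 0 < x - u := sub_pos.2 (lt_of_le_of_ne hu.2 hux)
    have hKu : (x - u) / h < K + 1 := lt_of_le_of_lt (by gcongr; exact hu.1.le) hKlt
    have key := abs_scaled_sum_grunwaldW_mul_max_sq_sub_rpow_le hα0 hα1 hh hux' hKu
    rw [← hc, sub_right_comm] at key
    rw [norm_mul, Real.norm_eq_abs, hG]
    calc _ ≤ ((30 + c) * h ^ 2 * (x - u) ^ (-α)) * B := by
          gcongr
          exact hB u ⟨hu.1.le, hu.2⟩
      _ = _ := by ring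
  have hsplit : ∫ u in b..x, G u * f₃ u =
      c * h ^ (-α) * (∫ u in b..x, (∑ n ∈ range (K + 1),
        grunwaldW α n * (max (x - u - n * h) 0 ^ 2 / 2)) * f₃ u) -
      ∫ u in b..x, max (x - α * h / 2 - u) 0 ^ (2 - α) * f₃ u := by
    have p : Continuous fun u : ℝ => max (x - α * h / 2 - u) 0 ^ (2 - α) :=
      ((continuous_const.sub continuous_id).max continuous_const).rpow_const fun _ => Or.inr h2.le
    rw [← intervalIntegral.integral_const_mul, ← intervalIntegral.integral_sub]
    · rw [hG]
      congr 1
      ext u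
      ring
    · exact ContinuousOn.intervalIntegrable_of_Icc hbx.le (by fun_prop)
    · exact (p.continuousOn.mul c₃).intervalIntegrable_of_Icc hbx.le
  have herr : c * (h ^ (-α) * shiftedGrunwald α b 0 h f₀ x - caputo α b f₀ (x - α * h / 2)) =
      (2 - α) * f₁ b * (Real.Gamma (1 - α) * (1 - α) *
        (h ^ (-α) * ∑ n ∈ range (K + 1), grunwaldW α n * (x - b - n * h)) -
          (x - b - α * h / 2) ^ (1 - α)) +
      f₂ b * (c * (h ^ (-α) * ∑ n ∈ range (K + 1),
          grunwaldW α n * (max (x - b - n * h) 0 ^ 2 / 2)) -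
        max (x - b - α * h / 2) 0 ^ (2 - α)) + ∫ u in b..x, G u * f₃ u := by
    rw [mul_sub, hcap, hgr, hsplit, sub_right_comm x _ b]
    linear_combination f₁ b * h ^ (-α) *
      (∑ n ∈ range (K + 1), grunwaldW α n * (x - b - n * h)) * hc
  have hfin : c * |h ^ (-α) * shiftedGrunwald α b 0 h f₀ x - caputo α b f₀ (x - α * h / 2)| ≤
      |(2 - α) * f₁ b| * (32 * (x - b) ^ (-1 - α) * h ^ 2) +
      |f₂ b| * ((30 + c) * h ^ 2 * (x - b) ^ (-α)) +
      (30 + c) * B * h ^ 2 * ∫ u in b..x, (x - u) ^ (-α) := by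
    rw [← abs_of_pos hc0, ← abs_mul, abs_of_pos hc0, herr]
    refine (abs_add_le _ _).trans (add_le_add ((abs_add_le _ _).trans (add_le_add ?_ ?_)) E3)
    · rw [abs_mul]; gcongr
    · rw [abs_mul]; gcongr
  rw [div_mul_eq_mul_div, le_div_iff₀ hc0]
  linarith

end Kernel

theorem ContDiffOn.hasDerivAt_iteratedDerivWithin {f : ℝ → ℝ} {s : Set ℝ} {n : WithTop ℕ∞} {m : ℕ}
    (hf : ContDiffOn ℝ n f s) (hs : UniqueDiffOn ℝ s) (hm : (m : WithTop ℕ∞) < n) {u : ℝ}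
    (hu : s ∈ 𝓝 u) :
    HasDerivAt (iteratedDerivWithin m f s) (iteratedDerivWithin (m + 1) f s u) u := by
  rw [iteratedDerivWithin_succ]
  exact ((hf.differentiableOn_iteratedDerivWithin hm hs) u
    (mem_of_mem_nhds hu)).hasDerivWithinAt.hasDerivAt hu

/-- the Grünwald formula is a second order approximation for the
Caputo derivative at the point `x - α h / 2`. -/
theorem grunwald_second_order
    (α b X : ℝ) (y : ℝ → ℝ)
    (hα0 : 0 < α) (hα1 : α < 1)
    (hy : ContDiffOn ℝ 4 y (Set.Icc b X))
    (hext : ∀ t, t < b → y t = 0)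
    (hyb : y b = 0) (hyb1 : deriv y b = 0) (hyb2 : deriv (deriv y) b = 0) :
    ∀ x, b < x → x < X →
      ∃ C > 0, ∃ h₀ > 0, ∀ h : ℝ, 0 < h → h < h₀ →
        |h ^ (-α) * shiftedGrunwald α b 0 h y x -
            caputo α b y (x - α * h / 2)| ≤ C * h ^ 2 := by
  intro x hbx hxX
  have hs : UniqueDiffOn ℝ (Set.Icc b X) := uniqueDiffOn_Icc (hbx.trans hxX)
  have hsub : Set.Icc b x ⊆ Set.Icc b X := Set.Icc_subset_Icc_right hxX.le
  have hc : ∀ m : ℕ, m ≤ 4 → ContinuousOn (iteratedDerivWithin m y (Set.Icc b X)) (Set.Icc b x) :=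
    fun m hm => (hy.continuousOn_iteratedDerivWithin (by exact_mod_cast hm) hs).mono hsub
  have hd : ∀ m : ℕ, m < 4 → ∀ u ∈ Set.Ioo b x,
      HasDerivAt (iteratedDerivWithin m y (Set.Icc b X))
        (iteratedDerivWithin (m + 1) y (Set.Icc b X) u) u :=
    fun m hm u hu => hy.hasDerivAt_iteratedDerivWithin hs (by exact_mod_cast hm)
      (Icc_mem_nhds hu.1 (hu.2.trans hxX))
  have c₀ := hc 0 (by norm_num)
  have d₀ := hd 0 (by norm_num)
  rw [iteratedDerivWithin_zero] at c₀ d₀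
  obtain ⟨C, hC⟩ := exists_abs_shiftedGrunwald_sub_caputo_le hα0 hα1 c₀ (hc 1 (by norm_num))
    (hc 2 (by norm_num)) (hc 3 (by norm_num)) d₀ (hd 1 (by norm_num)) (hd 2 (by norm_num)) hyb hbx
  refine ⟨max C 1, by positivity, x - b, sub_pos.2 hbx, fun h hh hhx => (hC h hh hhx).trans ?_⟩
  gcongr
  exact le_max_left _ _
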